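/- arXiv:1304.7482 — 5 statements merged into one kernel-verified Lean document; each statement's English description precedes it below -/
import Mathlib

section
/- Let p ≥ 1 and q ≥ 2, let m = p + q, and on ℝ^m let g(x,y) := −Σ_{i=1}^{p} x_i y_i + Σ_{i=p+1}^{m} x_i y_i, let π : ℝ^m → ℝ^m be the orthogonal projection onto the span of the last q coordinates, and define the trilinear map A(x,y)z := g(πy, πz)πx − g(πx, πz)πy with Jacobi operator J(ξ)η := A(η,ξ)ξ. Then: (i) for every ξ ∈ ℝ^m the characteristic polynomial of J(ξ) equals t^{p+1}·(t − |πξ|²)^{q−1}, where |πξ|² := Σ_{i=p+1}^m ξ_i²; (ii) for all ξ, η with g(ξ,ξ) = g(η,η) = 1 one has πξ ≠ 0, πη ≠ 0, and Spec{J(ξ)} = (|πξ|²/|πη|²)·Spec{J(η)} ≠ {0}, i.e. the spacelike projective Osserman condition holds. -/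
open Polynomial

/-- The spectrum of an endomorphism of `ℝ^m`: the set of complex roots of its
characteristic polynomial. -/
noncomputable def spec {m : ℕ} (f : (Fin m → ℝ) →ₗ[ℝ] (Fin m → ℝ)) : Set ℂ :=
  (LinearMap.charpoly f).rootSet ℂ

/-- The metric of signature `(p,q)` on `ℝ^m`, `m = p + q`:
`g(x,y) = -∑_{i<p} x_i y_i + ∑_{i≥p} x_i y_i`. -/
noncomputable def gpq (p m : ℕ) (x y : Fin m → ℝ) : ℝ :=
  ∑ i : Fin m, (if (i : ℕ) < p then (-1 : ℝ) else 1) * x i * y i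

/-- Orthogonal projection onto the span of the last `q` coordinates (as a function). -/
def piFun (p m : ℕ) (x : Fin m → ℝ) : Fin m → ℝ :=
  fun i => if (i : ℕ) < p then 0 else x i

/-- The curvature tensor `A(x,y)z = g(πy,πz)πx − g(πx,πz)πy`. -/
noncomputable def Acurv (p m : ℕ) (x y z : Fin m → ℝ) : Fin m → ℝ :=
  gpq p m (piFun p m y) (piFun p m z) • piFun p m x
    - gpq p m (piFun p m x) (piFun p m z) • piFun p m y

/-- Orthogonal projection onto the span of the last `q` coordinates, as a linear map. -/
noncomputable def piProj (p m : ℕ) : (Fin m → ℝ) →ₗ[ℝ] (Fin m → ℝ) :=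
  LinearMap.pi (fun i => if (i : ℕ) < p then 0 else LinearMap.proj i)

/-- The Jacobi operator `J(ξ) : η ↦ A(η,ξ)ξ = g(πξ,πξ)πη − g(πη,πξ)πξ` as a linear map. -/
noncomputable def jacPQ (p m : ℕ) (ξ : Fin m → ℝ) : (Fin m → ℝ) →ₗ[ℝ] (Fin m → ℝ) :=
  (∑ i : Fin m, if (i : ℕ) < p then (0 : ℝ) else ξ i ^ 2) • piProj p m
    - (∑ i : Fin m, (if (i : ℕ) < p then (0 : ℝ) else ξ i) • LinearMap.proj i).smulRight
        (piFun p m ξ)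

/-- The charpoly of the rank-one perturbation `(w ⬝ w) - w wᵀ` of a scalar matrix. -/
theorem charpoly_scalar_sub_vecMulVec {q : ℕ} (hq : 1 ≤ q) (w : Fin q → ℝ) :
    (Matrix.scalar (Fin q) (w ⬝ᵥ w) - Matrix.vecMulVec w w).charpoly
      = X * (X - C (w ⬝ᵥ w)) ^ (q - 1) := by
  have h : Matrix.scalar (Fin q) (w ⬝ᵥ w) - Matrix.vecMulVec w w
      = Matrix.vecMulVec (-w) w - Matrix.scalar (Fin q) (-(w ⬝ᵥ w)) := by
    rw [map_neg, Matrix.neg_vecMulVec]; abel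
  obtain ⟨k, rfl⟩ : ∃ k, q = k + 1 := ⟨q - 1, by omega⟩
  rw [h, Matrix.charpoly_sub_scalar, Matrix.charpoly_vecMulVec]
  simp only [Fintype.card_fin, Nat.add_sub_cancel, smul_eq_C_mul, neg_dotProduct,
    map_neg, sub_comp, mul_comp, pow_comp, X_comp, C_comp, neg_comp]
  ring

theorem sum_tail_sq {p q : ℕ} (ξ : Fin (p + q) → ℝ) :
    (∑ i : Fin (p + q), if (i : ℕ) < p then (0 : ℝ) else ξ i ^ 2)
      = (fun j => ξ (Fin.natAdd p j)) ⬝ᵥ (fun j => ξ (Fin.natAdd p j)) := by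
  simp [Fin.sum_univ_add, dotProduct, sq]

theorem jacPQ_apply (p m : ℕ) (ξ η : Fin m → ℝ) (i : Fin m) :
    jacPQ p m ξ η i
      = (∑ j : Fin m, if (j : ℕ) < p then (0 : ℝ) else ξ j ^ 2) * piFun p m η i
        - (∑ j : Fin m, (if (j : ℕ) < p then (0 : ℝ) else ξ j) * η j) * piFun p m ξ i := by
  have h : piProj p m η i = piFun p m η i := by
    simp only [piProj, piFun, LinearMap.pi_apply]
    split_ifs <;> rfl
  simp [jacPQ, h, -ite_smul, -ite_mul]

theorem charpoly_jacPQ {p q : ℕ} (hq : 1 ≤ q) (ξ : Fin (p + q) → ℝ) :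
    (jacPQ p (p + q) ξ).charpoly
      = X ^ (p + 1) *
        (X - C (∑ i : Fin (p + q), if (i : ℕ) < p then (0 : ℝ) else ξ i ^ 2)) ^ (q - 1) := by
  set w : Fin q → ℝ := fun j => ξ (Fin.natAdd p j) with hw
  have hne (i : Fin q) (j : Fin p) : Fin.natAdd p i ≠ Fin.castAdd q j := fun hij => by
    have := congrArg Fin.val hij
    simp only [Fin.val_natAdd, Fin.val_castAdd] at this
    omega
  have h : (LinearMap.toMatrix' (jacPQ p (p + q) ξ)).reindex finSumFinEquiv.symm finSumFinEquiv.symm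
      = Matrix.fromBlocks 0 0 0 (Matrix.scalar (Fin q) (w ⬝ᵥ w) - Matrix.vecMulVec w w) := by
    ext (i | i) (j | j) <;>
      simp [LinearMap.toMatrix'_apply, jacPQ_apply, piFun, sum_tail_sq, Matrix.vecMulVec_apply,
        Matrix.diagonal_apply, Pi.single_apply, hne, hw]
    ring
  have hM : (LinearMap.toMatrix' (jacPQ p (p + q) ξ)).charpoly = (jacPQ p (p + q) ξ).charpoly :=
    LinearMap.charpoly_toMatrix _ (Pi.basisFun ℝ (Fin (p + q)))
  rw [← hM, ← Matrix.charpoly_reindex finSumFinEquiv.symm, h, Matrix.charpoly_fromBlocks_zero₁₂,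
    charpoly_scalar_sub_vecMulVec hq, Matrix.charpoly_zero, Fintype.card_fin, sum_tail_sq]
  ring

/-- A spacelike unit vector has a tail of positive square length. -/
theorem sum_tail_sq_pos {p m : ℕ} {ξ : Fin m → ℝ} (h : gpq p m ξ ξ = 1) :
    0 < ∑ i : Fin m, if (i : ℕ) < p then (0 : ℝ) else ξ i ^ 2 := by
  refine zero_lt_one.trans_le (h ▸ Finset.sum_le_sum fun i _ => ?_)
  split_ifs <;> nlinarith [sq_nonneg (ξ i)]

theorem piFun_ne_zero {p m : ℕ} {ξ : Fin m → ℝ} (h : gpq p m ξ ξ = 1) : piFun p m ξ ≠ 0 := by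
  intro h0
  refine (sum_tail_sq_pos h).ne' (Finset.sum_eq_zero fun i _ => ?_)
  have := congrFun h0 i
  simp only [piFun, Pi.zero_apply] at this
  split_ifs at this ⊢ <;> simp [*]

theorem spec_jacPQ {p q : ℕ} (hq : 2 ≤ q) (ξ : Fin (p + q) → ℝ) :
    spec (jacPQ p (p + q) ξ)
      = {0, ((∑ i : Fin (p + q), if (i : ℕ) < p then (0 : ℝ) else ξ i ^ 2 : ℝ) : ℂ)} := by
  ext z
  rw [spec, mem_rootSet_of_ne (LinearMap.charpoly_monic _).ne_zero,
    charpoly_jacPQ (by omega)]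
  generalize (∑ i : Fin (p + q), if (i : ℕ) < p then (0 : ℝ) else ξ i ^ 2) = s
  simp [sub_eq_zero, show q - 1 ≠ 0 by omega]

/-- The product of flat negative definite `ℝ^p` with the round sphere `S^q` is
spacelike projective Osserman: (i) the Jacobi operator of the curvature model is
the stated linear map; (ii) its characteristic polynomial is
`t^(p+1)·(t − |πξ|²)^(q−1)`; (iii) for spacelike unit vectors `ξ, η` one has
`πξ ≠ 0`, `πη ≠ 0` and `Spec J(ξ) = (|πξ|²/|πη|²)·Spec J(η) ≠ {0}`. -/
theorem stmt_2 (p q : ℕ) (hp : 1 ≤ p) (hq : 2 ≤ q) :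
    (∀ ξ η : Fin (p + q) → ℝ, jacPQ p (p + q) ξ η = Acurv p (p + q) η ξ ξ) ∧
    (∀ ξ : Fin (p + q) → ℝ,
      (jacPQ p (p + q) ξ).charpoly
        = X ^ (p + 1) *
          (X - C (∑ i : Fin (p + q), if (i : ℕ) < p then (0 : ℝ) else ξ i ^ 2)) ^ (q - 1)) ∧
    (∀ ξ η : Fin (p + q) → ℝ,
      gpq p (p + q) ξ ξ = 1 → gpq p (p + q) η η = 1 →
      piFun p (p + q) ξ ≠ 0 ∧ piFun p (p + q) η ≠ 0 ∧
      spec (jacPQ p (p + q) ξ)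
        = (fun μ : ℂ =>
            (((∑ i : Fin (p + q), if (i : ℕ) < p then (0 : ℝ) else ξ i ^ 2) /
              (∑ i : Fin (p + q), if (i : ℕ) < p then (0 : ℝ) else η i ^ 2) : ℝ) : ℂ) * μ) ''
            spec (jacPQ p (p + q) η) ∧
      spec (jacPQ p (p + q) ξ) ≠ {0}) := by
  refine ⟨fun ξ η => ?_, charpoly_jacPQ (by omega), fun ξ η hξ hη =>
    ⟨piFun_ne_zero hξ, piFun_ne_zero hη, ?_, ?_⟩⟩
  · ext i
    simp only [jacPQ_apply, Acurv, gpq, Pi.sub_apply, Pi.smul_apply, smul_eq_mul]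
    congr 2 <;>
    · refine Finset.sum_congr rfl fun j _ => ?_
      simp only [piFun]
      split_ifs <;> ring
  · have := (sum_tail_sq_pos hη).ne'
    rw [spec_jacPQ hq, spec_jacPQ hq, Set.image_pair, mul_zero, ← Complex.ofReal_mul,
      div_mul_cancel₀ _ this]
  · rw [spec_jacPQ hq]
    intro h
    have h1 : ((∑ i : Fin (p + q), if (i : ℕ) < p then (0 : ℝ) else ξ i ^ 2 : ℝ) : ℂ)
        ∈ ({0} : Set ℂ) := h ▸ Set.mem_insert_of_mem _ rfl
    exact (sum_tail_sq_pos hξ).ne' (Complex.ofReal_eq_zero.mp (Set.mem_singleton_iff.mp h1))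
end

section
/- Let p ≥ 1 and q ≥ 2, let m = p + q, and on ℝ^m let g(x,y) := −Σ_{i=1}^{p} x_i y_i + Σ_{i=p+1}^{m} x_i y_i, let π : ℝ^m → ℝ^m be the orthogonal projection onto the span of the last q coordinates, and define A(x,y)z := g(πy, πz)πx − g(πx, πz)πy with Jacobi operator J(ξ)η := A(η,ξ)ξ. Then there exist ξ and η with g(ξ,ξ) = −1 and g(η,η) = −1 such that Spec{J(ξ)} = {0} while Spec{J(η)} ≠ {0}. Consequently the timelike projective Osserman condition fails: it is not the case that for every pair of vectors ξ, η with g(ξ,ξ) = g(η,η) = −1 there exists a real s ≠ 0 with Spec{J(ξ)} = s·Spec{J(η)} ≠ {0}. -/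
open Polynomial

theorem spec_zero {m : ℕ} (hm : m ≠ 0) : spec (0 : (Fin m → ℝ) →ₗ[ℝ] (Fin m → ℝ)) = {0} := by
  ext z
  simp [spec, LinearMap.charpoly_zero, Polynomial.mem_rootSet, hm]

theorem ofReal_mem_spec {m : ℕ} {f : (Fin m → ℝ) →ₗ[ℝ] (Fin m → ℝ)} {r : ℝ}
    (hr : Module.End.HasEigenvalue f r) : (r : ℂ) ∈ spec f := by
  rw [Module.End.hasEigenvalue_iff_isRoot_charpoly] at hr
  refine Polynomial.mem_rootSet.2 ⟨f.charpoly_monic.ne_zero, ?_⟩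
  have h := Polynomial.aeval_algebraMap_apply ℂ r f.charpoly
  rwa [Polynomial.coe_aeval_eq_eval, hr.eq_zero, map_zero] at h

/-- A vector supported on the negative coordinates has vanishing Jacobi operator. -/
theorem jacPQ_eq_zero {p m : ℕ} {ξ : Fin m → ℝ} (h : piFun p m ξ = 0) : jacPQ p m ξ = 0 := by
  have h' : ∀ i : Fin m, ¬ (i : ℕ) < p → ξ i = 0 := fun i hi => by
    simpa [piFun, hi] using congrFun h i
  have h0 : (∑ i : Fin m, if (i : ℕ) < p then (0 : ℝ) else ξ i ^ 2) = 0 :=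
    Finset.sum_eq_zero fun i _ => by
      split_ifs with hi
      · rfl
      · simp [h' i hi]
  rw [jacPQ, h0, h]
  ext
  simp

/-- On a coordinate vector of the sphere factor orthogonal to `ξ`, the Jacobi operator is
multiplication by `g(πξ,πξ)`. -/
theorem jacPQ_single {p m : ℕ} {ξ : Fin m → ℝ} {c : Fin m} (hc : p ≤ c) (h : ξ c = 0) :
    jacPQ p m ξ (Pi.single c 1)
      = (∑ i : Fin m, if (i : ℕ) < p then (0 : ℝ) else ξ i ^ 2) • Pi.single c 1 := by
  have h1 : piProj p m (Pi.single c 1) = Pi.single c 1 := by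
    ext i
    by_cases hi : (i : ℕ) < p
    · have : i ≠ c := by rintro rfl; omega
      simp [piProj, hi, this]
    · simp [piProj, hi]
  have h2 : (∑ i : Fin m, (if (i : ℕ) < p then (0 : ℝ) else ξ i) •
      (LinearMap.proj i : (Fin m → ℝ) →ₗ[ℝ] ℝ)) (Pi.single c 1) = 0 := by
    rw [LinearMap.sum_apply]
    refine Finset.sum_eq_zero fun i _ => ?_
    rw [LinearMap.smul_apply, LinearMap.proj_apply]
    by_cases hi : i = c
    · simp [hi, h]
    · simp [hi]
  rw [jacPQ, LinearMap.sub_apply, LinearMap.smul_apply, LinearMap.smulRight_apply, h1, h2,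
    zero_smul, sub_zero]

/-- The product of flat negative definite `ℝ^p` with the round sphere `S^q` is
NOT timelike projective Osserman: there are timelike unit vectors `ξ, η` with
`Spec J(ξ) = {0}` while `Spec J(η) ≠ {0}`; in particular the timelike projective
Osserman condition fails. -/
theorem stmt_3 (p q : ℕ) (hp : 1 ≤ p) (hq : 2 ≤ q) :
    (∃ ξ η : Fin (p + q) → ℝ,
      gpq p (p + q) ξ ξ = -1 ∧ gpq p (p + q) η η = -1 ∧
      spec (jacPQ p (p + q) ξ) = {0} ∧ spec (jacPQ p (p + q) η) ≠ {0}) ∧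
    ¬ (∀ ξ η : Fin (p + q) → ℝ,
        gpq p (p + q) ξ ξ = -1 → gpq p (p + q) η η = -1 →
        ∃ s : ℝ, s ≠ 0 ∧
          spec (jacPQ p (p + q) ξ)
            = (fun μ : ℂ => (s : ℂ) * μ) '' spec (jacPQ p (p + q) η) ∧
          spec (jacPQ p (p + q) ξ) ≠ {0}) := by
  obtain ⟨a, ha⟩ : ∃ a : Fin (p + q), (a : ℕ) = 0 := ⟨⟨0, by omega⟩, rfl⟩
  obtain ⟨b, hb⟩ : ∃ b : Fin (p + q), (b : ℕ) = p := ⟨⟨p, by omega⟩, rfl⟩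
  obtain ⟨c, hc⟩ : ∃ c : Fin (p + q), (c : ℕ) = p + 1 := ⟨⟨p + 1, by omega⟩, rfl⟩
  have hap : (a : ℕ) < p := by omega
  have hba : b ≠ a := fun h => by rw [h] at hb; omega
  have hca : c ≠ a := fun h => by rw [h] at hc; omega
  have hcb : c ≠ b := fun h => by rw [h] at hc; omega
  have hgξ : gpq p (p + q) (Pi.single a 1) (Pi.single a 1) = -1 := by
    simp [gpq, Pi.single_apply, hap]
  have hξ : spec (jacPQ p (p + q) (Pi.single a 1)) = {0} := by
    rw [jacPQ_eq_zero, spec_zero (by omega)]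
    ext i
    by_cases hi : (i : ℕ) < p
    · simp [piFun, hi]
    · have : i ≠ a := fun h => hi (h ▸ hap)
      simp [piFun, this]
  refine ⟨⟨Pi.single a 1, Pi.single a (√2) + Pi.single b 1, hgξ, ?_, hξ, ?_⟩, fun h => ?_⟩
  · simp only [gpq, Pi.add_apply]
    rw [Fintype.sum_eq_add a b hba.symm fun i hi => by simp [hi.1, hi.2]]
    simp [hba, hba.symm, hap, hb]
    norm_num
  · have hs : (∑ i : Fin (p + q), if (i : ℕ) < p then (0 : ℝ) else
        (Pi.single a (√2) + Pi.single b 1 : Fin (p + q) → ℝ) i ^ 2) = 1 := by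
      rw [Fintype.sum_eq_single b fun i hi => ?_]
      · simp [hb, hba]
      · by_cases hia : i = a
        · simp [hia, hap]
        · simp [hi, hia]
    have he := jacPQ_single (p := p) (ξ := Pi.single a (√2) + Pi.single b 1) (c := c)
      (by omega) (by simp [hca, hcb])
    rw [hs] at he
    have hmem := ofReal_mem_spec (Module.End.hasEigenvalue_of_hasEigenvector
      (Module.End.hasEigenvector_iff.2 ⟨Module.End.mem_eigenspace_iff.2 he, by simp⟩))
    intro h0
    rw [h0] at hmem
    simp at hmem
  · obtain ⟨s, -, -, hne⟩ := h _ _ hgξ hgξ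
    exact hne hξ
end

section
/- Fix ε ∈ ℝ and m ≥ 2, and on ℝ^m define A_ε(x,y)z := ⟨y,z⟩x − ⟨x,z⟩y − ε(x₁y₂ − x₂y₁)(z₁e₁ + z₂e₂). Then (ℝ^m, A_ε) is an affine curvature model (A_ε(x,y)z = −A_ε(y,x)z and A_ε satisfies the first Bianchi identity), and for every x ∈ ℝ^m the characteristic polynomial of the Jacobi operator J(x) equals t·(t − ⟨x,x⟩)^{m−1}. In particular, for every nonzero x, Spec{J(x)} = {0, ⟨x,x⟩} with 0 of multiplicity 1 and ⟨x,x⟩ > 0 of multiplicity m−1, so (ℝ^m, A_ε) is an affine projective Osserman model for every ε. -/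
open Polynomial

/-- The curvature tensor of Theorem 1.11:
`A_ε(x,y)z = ⟨y,z⟩x − ⟨x,z⟩y − ε(x₁y₂ − x₂y₁)(z₁e₁ + z₂e₂)`. -/
noncomputable def Aeps (m : ℕ) (hm : 2 ≤ m) (ε : ℝ) (x y z : Fin m → ℝ) :
    Fin m → ℝ :=
  (∑ i, y i * z i) • x - (∑ i, x i * z i) • y -
    (ε * (x ⟨0, by omega⟩ * y ⟨1, by omega⟩ - x ⟨1, by omega⟩ * y ⟨0, by omega⟩)) •
      (z ⟨0, by omega⟩ • (Pi.single (⟨0, by omega⟩ : Fin m) (1 : ℝ) : Fin m → ℝ) +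
       z ⟨1, by omega⟩ • (Pi.single (⟨1, by omega⟩ : Fin m) (1 : ℝ) : Fin m → ℝ))

/-- The Euclidean inner product with `x` as a linear functional. -/
noncomputable def dotL (m : ℕ) (x : Fin m → ℝ) : (Fin m → ℝ) →ₗ[ℝ] ℝ :=
  ∑ i, x i • LinearMap.proj i

/-- The Jacobi operator `J(x) : w ↦ A_ε(w,x)x` of the model `𝔐_ε` as a linear map. -/
noncomputable def jacAeps (m : ℕ) (hm : 2 ≤ m) (ε : ℝ) (x : Fin m → ℝ) :
    (Fin m → ℝ) →ₗ[ℝ] (Fin m → ℝ) :=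
  (∑ i, x i * x i) • LinearMap.id
  - (dotL m x).smulRight x
  - (ε • (x ⟨1, by omega⟩ • (LinearMap.proj (⟨0, by omega⟩ : Fin m) : (Fin m → ℝ) →ₗ[ℝ] ℝ)
        - x ⟨0, by omega⟩ • (LinearMap.proj (⟨1, by omega⟩ : Fin m) : (Fin m → ℝ) →ₗ[ℝ] ℝ))).smulRight
      (x ⟨0, by omega⟩ • (Pi.single (⟨0, by omega⟩ : Fin m) (1 : ℝ) : Fin m → ℝ)
       + x ⟨1, by omega⟩ • (Pi.single (⟨1, by omega⟩ : Fin m) (1 : ℝ) : Fin m → ℝ))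

/-- The characteristic polynomial of a perturbation of `c • id` by two rank one maps, where the
second functional vanishes on both image vectors. -/
theorem charpoly_smul_id_sub_smulRight {R n : Type*} [CommRing R] [Nontrivial R] [Fintype n]
    [DecidableEq n] (hn : 2 ≤ Fintype.card n) (c : R) (φ ψ : (n → R) →ₗ[R] R) (u v : n → R)
    (hφu : φ u = c) (hψu : ψ u = 0) (hψv : ψ v = 0) :
    (c • LinearMap.id - φ.smulRight u - ψ.smulRight v).charpoly =
      X * (X - C c) ^ (Fintype.card n - 1) := by
  let A : Matrix n (Fin 2) R := Matrix.of fun i => ![-u i, -v i]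
  let B : Matrix (Fin 2) n R :=
    Matrix.of ![fun j => φ (Pi.single j 1), fun j => ψ (Pi.single j 1)]
  have apply_eq (χ : (n → R) →ₗ[R] R) (w : n → R) :
      ∑ j, χ (Pi.single j 1) * w j = χ w := by
    conv_rhs => rw [pi_eq_sum_univ' w, map_sum]
    refine Finset.sum_congr rfl fun j _ => ?_
    rw [map_smul, smul_eq_mul, mul_comm]
  have hM : LinearMap.toMatrix' (c • LinearMap.id - φ.smulRight u - ψ.smulRight v) =
      A * B - Matrix.scalar n (-c) := by
    ext i j
    simp [A, B, Matrix.mul_apply, Fin.sum_univ_two, LinearMap.toMatrix'_apply,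
      Matrix.diagonal_apply, Pi.single_apply]
    split_ifs <;> ring
  have hBA : B * A = !![-c, -φ v; 0, 0] := by
    ext i j
    fin_cases i <;> fin_cases j <;>
      simp [A, B, Matrix.mul_apply, apply_eq, hφu, hψu, hψv]
  obtain ⟨k, hk⟩ := Nat.exists_eq_add_of_le' hn
  rw [← LinearMap.charpoly_toMatrix _ (Pi.basisFun R n), LinearMap.toMatrix_eq_toMatrix', hM,
    Matrix.charpoly_sub_scalar, Matrix.charpoly_mul_comm_of_le A B (by simpa using hn), hBA,
    Matrix.charpoly_fin_two, hk]
  simp [Matrix.trace_fin_two, Matrix.det_fin_two]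
  ring

theorem dotL_apply (m : ℕ) (x y : Fin m → ℝ) : dotL m x y = ∑ i, x i * y i := by
  simp [dotL]

theorem jacAeps_charpoly (m : ℕ) (hm : 2 ≤ m) (ε : ℝ) (x : Fin m → ℝ) :
    (jacAeps m hm ε x).charpoly = X * (X - C (∑ i, x i * x i)) ^ (m - 1) := by
  have h := charpoly_smul_id_sub_smulRight (n := Fin m) (by simpa using hm) (∑ i, x i * x i)
    (dotL m x)
    (ε • (x ⟨1, by omega⟩ • (LinearMap.proj (⟨0, by omega⟩ : Fin m) : (Fin m → ℝ) →ₗ[ℝ] ℝ)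
        - x ⟨0, by omega⟩ • (LinearMap.proj (⟨1, by omega⟩ : Fin m) : (Fin m → ℝ) →ₗ[ℝ] ℝ)))
    x
    (x ⟨0, by omega⟩ • (Pi.single (⟨0, by omega⟩ : Fin m) (1 : ℝ) : Fin m → ℝ)
       + x ⟨1, by omega⟩ • (Pi.single (⟨1, by omega⟩ : Fin m) (1 : ℝ) : Fin m → ℝ))
    (dotL_apply m x x) (by simp; right; ring) (by simp; right; ring)
  rw [Fintype.card_fin] at h
  exact h

theorem sum_mul_self_pos {ι : Type*} [Fintype ι] {x : ι → ℝ} (hx : x ≠ 0) :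
    0 < ∑ i, x i * x i := by
  obtain ⟨i, hi⟩ := Function.ne_iff.mp hx
  exact Finset.sum_pos' (fun j _ => mul_self_nonneg (x j))
    ⟨i, Finset.mem_univ i, mul_self_pos.mpr hi⟩

theorem spec_jacAeps (m : ℕ) (hm : 2 ≤ m) (ε : ℝ) (x : Fin m → ℝ) :
    spec (jacAeps m hm ε x) = {0, ((∑ i, x i * x i : ℝ) : ℂ)} := by
  ext z
  rw [spec, (LinearMap.charpoly_monic _).mem_rootSet, jacAeps_charpoly]
  have hm' : m - 1 ≠ 0 := by omega
  simp only [map_mul, map_pow, map_sub, aeval_X, aeval_C, mul_eq_zero, pow_eq_zero_iff hm',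
    sub_eq_zero, Set.mem_insert_iff, Set.mem_singleton_iff, Complex.coe_algebraMap]

/-- Theorem 1.11(1): `(ℝ^m, A_ε)` is an affine curvature model; the Jacobi
operator `J(x)` has characteristic polynomial `t·(t − ⟨x,x⟩)^(m−1)`; for
nonzero `x`, `Spec J(x) = {0, ⟨x,x⟩}` with `⟨x,x⟩ > 0`; hence `(ℝ^m, A_ε)` is an
affine projective Osserman model for every `ε`. -/
theorem stmt_8 (m : ℕ) (hm : 2 ≤ m) (ε : ℝ) :
    (∀ x y z : Fin m → ℝ, Aeps m hm ε x y z = - Aeps m hm ε y x z) ∧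
    (∀ x y z : Fin m → ℝ,
      Aeps m hm ε x y z + Aeps m hm ε y z x + Aeps m hm ε z x y = 0) ∧
    (∀ x w : Fin m → ℝ, jacAeps m hm ε x w = Aeps m hm ε w x x) ∧
    (∀ x : Fin m → ℝ,
      (jacAeps m hm ε x).charpoly = X * (X - C (∑ i, x i * x i)) ^ (m - 1)) ∧
    (∀ x : Fin m → ℝ, x ≠ 0 →
      (0 < ∑ i, x i * x i) ∧
      spec (jacAeps m hm ε x) = {0, ((∑ i, x i * x i : ℝ) : ℂ)}) ∧
    (∀ v w : Fin m → ℝ, v ≠ 0 → w ≠ 0 → ∃ s : ℝ, s ≠ 0 ∧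
      spec (jacAeps m hm ε v) = (fun μ : ℂ => (s : ℂ) * μ) '' spec (jacAeps m hm ε w) ∧
      spec (jacAeps m hm ε v) ≠ {0}) := by
  refine ⟨fun x y z => ?_, fun x y z => ?_, fun x w => ?_, jacAeps_charpoly m hm ε,
    fun x hx => ⟨sum_mul_self_pos hx, spec_jacAeps m hm ε x⟩, fun v w hv hw => ?_⟩
  · ext i
    simp only [Aeps, Pi.sub_apply, Pi.add_apply, Pi.smul_apply, Pi.neg_apply, smul_eq_mul]
    ring
  · have hxy := Finset.sum_congr rfl fun i (_ : i ∈ Finset.univ) => mul_comm (x i) (y i)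
    have hyz := Finset.sum_congr rfl fun i (_ : i ∈ Finset.univ) => mul_comm (y i) (z i)
    have hzx := Finset.sum_congr rfl fun i (_ : i ∈ Finset.univ) => mul_comm (z i) (x i)
    ext i
    simp only [Aeps, Pi.sub_apply, Pi.add_apply, Pi.smul_apply, Pi.zero_apply, smul_eq_mul,
      hxy, hyz, hzx]
    ring
  · have hwx := Finset.sum_congr rfl fun i (_ : i ∈ Finset.univ) => mul_comm (w i) (x i)
    ext i
    simp only [Aeps, jacAeps, LinearMap.sub_apply, LinearMap.smul_apply, LinearMap.id_apply,
      LinearMap.smulRight_apply, LinearMap.proj_apply, dotL_apply, Pi.sub_apply, Pi.add_apply,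
      Pi.smul_apply, smul_eq_mul, hwx]
    ring
  · have hv' := (sum_mul_self_pos hv).ne'
    have hw' := (sum_mul_self_pos hw).ne'
    refine ⟨(∑ i, v i * v i) / ∑ i, w i * w i, div_ne_zero hv' hw', ?_, ?_⟩
    · rw [spec_jacAeps, spec_jacAeps, Set.image_pair, mul_zero, ← Complex.ofReal_mul,
        div_mul_cancel₀ _ hw']
    · rw [spec_jacAeps]
      intro h
      have hmem : ((∑ i, v i * v i : ℝ) : ℂ) ∈ ({0} : Set ℂ) := h ▸ by simp
      exact hv' (Complex.ofReal_eq_zero.mp hmem)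
end

section
/- Let m = 2n with n ≥ 2 and let J : ℝ^m → ℝ^m be the standard orthogonal complex structure, J e_{2j−1} = e_{2j} and J e_{2j} = −e_{2j−1} for 1 ≤ j ≤ n. Define A₀(x,y)z := ⟨y,z⟩x − ⟨x,z⟩y, A_J(x,y)z := ⟨Jy,z⟩Jx − ⟨Jx,z⟩Jy − 2⟨Jx,y⟩Jz, and ℰ(x,y)z := −(x₁y₂ − x₂y₁)(z₁e₁ + z₂e₂). Fix λ₀, λ₁, ε ∈ ℝ and set A := λ₀A₀ + λ₁A_J + εℰ. Then for every x ∈ ℝ^m with ⟨x,x⟩ = 1, the characteristic polynomial of the Jacobi operator J_A(x) equals t·(t − (λ₀ + 3λ₁))·(t − λ₀)^{m−2}. In particular, if (λ₀, λ₁) ≠ (0,0), then (ℝ^m, A) is an affine projective Osserman curvature model for every ε. -/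
open Polynomial

/-- The standard orthogonal complex structure on `ℝ^(2n)` (as a function):
`J e_{2j} = e_{2j+1}`, `J e_{2j+1} = −e_{2j}` (0-based indexing). -/
def JstdFun (n : ℕ) (x : Fin (2 * n) → ℝ) : Fin (2 * n) → ℝ := fun i =>
  if h : (i : ℕ) % 2 = 0 then -x ⟨(i : ℕ) + 1, by have := i.2; omega⟩
  else x ⟨(i : ℕ) - 1, by have := i.2; omega⟩

/-- The standard orthogonal complex structure on `ℝ^(2n)` as a linear map. -/
def Jstd (n : ℕ) : (Fin (2 * n) → ℝ) →ₗ[ℝ] (Fin (2 * n) → ℝ) where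
  toFun := JstdFun n
  map_add' x y := by
    funext i
    simp only [JstdFun, Pi.add_apply]
    split <;> ring
  map_smul' c x := by
    funext i
    simp only [JstdFun, Pi.smul_apply, smul_eq_mul, RingHom.id_apply]
    split <;> ring

/-- `A₀(x,y)z = ⟨y,z⟩x − ⟨x,z⟩y`. -/
noncomputable def A0f (m : ℕ) (x y z : Fin m → ℝ) : Fin m → ℝ :=
  (∑ i, y i * z i) • x - (∑ i, x i * z i) • y

/-- `A_J(x,y)z = ⟨Jy,z⟩Jx − ⟨Jx,z⟩Jy − 2⟨Jx,y⟩Jz` for an endomorphism `J`. -/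
noncomputable def AJf (m : ℕ) (Jm : (Fin m → ℝ) → (Fin m → ℝ)) (x y z : Fin m → ℝ) :
    Fin m → ℝ :=
  (∑ i, Jm y i * z i) • Jm x - (∑ i, Jm x i * z i) • Jm y
    - (2 * ∑ i, Jm x i * y i) • Jm z

/-- The perturbation `ℰ(x,y)z = −(x₁y₂ − x₂y₁)(z₁e₁ + z₂e₂)`. -/
noncomputable def Ef (m : ℕ) (hm : 2 ≤ m) (x y z : Fin m → ℝ) : Fin m → ℝ :=
  -((x ⟨0, by omega⟩ * y ⟨1, by omega⟩ - x ⟨1, by omega⟩ * y ⟨0, by omega⟩) •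
      (z ⟨0, by omega⟩ • (Pi.single (⟨0, by omega⟩ : Fin m) (1 : ℝ) : Fin m → ℝ)
        + z ⟨1, by omega⟩ • (Pi.single (⟨1, by omega⟩ : Fin m) (1 : ℝ) : Fin m → ℝ)))

/-- The Jacobi operator `J_A(x) : w ↦ (λ₀A₀ + λ₁A_J + εℰ)(w,x)x` of the
perturbed Fubini–Study model, as a linear map. -/
noncomputable def jacCplx (n : ℕ) (hn : 1 ≤ n) (l0 l1 ε : ℝ) (x : Fin (2 * n) → ℝ) :
    (Fin (2 * n) → ℝ) →ₗ[ℝ] (Fin (2 * n) → ℝ) :=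
  l0 • ((∑ i, x i * x i) • LinearMap.id - (dotL (2 * n) x).smulRight x)
  + l1 • ((∑ i, Jstd n x i * x i) • Jstd n
      - ((dotL (2 * n) x) ∘ₗ Jstd n).smulRight (Jstd n x)
      - (2 : ℝ) • (((dotL (2 * n) x) ∘ₗ Jstd n).smulRight (Jstd n x)))
  + ε • (-(((x ⟨1, by omega⟩ •
          (LinearMap.proj (⟨0, by omega⟩ : Fin (2 * n)) : (Fin (2 * n) → ℝ) →ₗ[ℝ] ℝ))
        - (x ⟨0, by omega⟩ •
          (LinearMap.proj (⟨1, by omega⟩ : Fin (2 * n)) : (Fin (2 * n) → ℝ) →ₗ[ℝ] ℝ))).smulRight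
      (x ⟨0, by omega⟩ • (Pi.single (⟨0, by omega⟩ : Fin (2 * n)) (1 : ℝ) : Fin (2 * n) → ℝ)
        + x ⟨1, by omega⟩ • (Pi.single (⟨1, by omega⟩ : Fin (2 * n)) (1 : ℝ) : Fin (2 * n) → ℝ))))

open Matrix

theorem dotL_apply_s12 (m : ℕ) (x w : Fin m → ℝ) : dotL m x w = x ⬝ᵥ w := by
  simp [dotL, dotProduct]

/-- The involution of `Fin (2 * n)` exchanging `2j` and `2j + 1`. -/
def pairSwap (n : ℕ) (i : Fin (2 * n)) : Fin (2 * n) :=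
  if h : (i : ℕ) % 2 = 0 then ⟨(i : ℕ) + 1, by have := i.2; omega⟩
  else ⟨(i : ℕ) - 1, by have := i.2; omega⟩

theorem pairSwap_involutive (n : ℕ) : Function.Involutive (pairSwap n) := by
  intro i
  ext
  by_cases h : (i : ℕ) % 2 = 0
  · have h' : ¬ ((i : ℕ) + 1) % 2 = 0 := by omega
    simp [pairSwap, h, h']
  · have h' : ((i : ℕ) - 1) % 2 = 0 := by omega
    simp only [pairSwap, h, h', dite_true, dite_false]
    omega

theorem Jstd_apply_pairSwap (n : ℕ) (x y : Fin (2 * n) → ℝ) (i : Fin (2 * n)) :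
    Jstd n x (pairSwap n i) * y (pairSwap n i) = -(x i * Jstd n y i) := by
  change JstdFun n x (pairSwap n i) * y (pairSwap n i) = -(x i * JstdFun n y i)
  by_cases h : (i : ℕ) % 2 = 0
  · have h' : ¬ ((i : ℕ) + 1) % 2 = 0 := by omega
    simp [pairSwap, JstdFun, h, h']
  · have h' : ((i : ℕ) - 1) % 2 = 0 := by omega
    have h'' : (i : ℕ) - 1 + 1 = i := by omega
    simp [pairSwap, JstdFun, h, h', h'']

theorem Jstd_dotProduct (n : ℕ) (x y : Fin (2 * n) → ℝ) :
    Jstd n x ⬝ᵥ y = -(x ⬝ᵥ Jstd n y) := by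
  simp only [dotProduct]
  rw [← Equiv.sum_comp (pairSwap_involutive n).toPerm, ← Finset.sum_neg_distrib]
  exact Finset.sum_congr rfl fun i _ => Jstd_apply_pairSwap n x y i

theorem Jstd_Jstd (n : ℕ) (x : Fin (2 * n) → ℝ) : Jstd n (Jstd n x) = -x := by
  funext i
  change JstdFun n (JstdFun n x) i = -x i
  by_cases h : (i : ℕ) % 2 = 0
  · have h' : ¬ ((i : ℕ) + 1) % 2 = 0 := by omega
    simp [JstdFun, h, h']
  · have h' : ((i : ℕ) - 1) % 2 = 0 := by omega
    have h'' : (i : ℕ) - 1 + 1 = i := by omega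
    simp [JstdFun, h, h', h'']

theorem dotProduct_Jstd_self (n : ℕ) (x : Fin (2 * n) → ℝ) : x ⬝ᵥ Jstd n x = 0 := by
  have h := Jstd_dotProduct n x x
  rw [dotProduct_comm] at h
  linarith

theorem Jstd_dotProduct_self (n : ℕ) (x : Fin (2 * n) → ℝ) : Jstd n x ⬝ᵥ x = 0 := by
  rw [dotProduct_comm, dotProduct_Jstd_self]

theorem Jstd_dotProduct_Jstd (n : ℕ) (x : Fin (2 * n) → ℝ) :
    Jstd n x ⬝ᵥ Jstd n x = x ⬝ᵥ x := by
  rw [Jstd_dotProduct, Jstd_Jstd, dotProduct_neg, neg_neg]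

/-- The characteristic polynomial of a rank-three perturbation of a scalar operator. -/
theorem charpoly_add_scalar_mul {m : ℕ} (hm : 3 ≤ m) (U : Matrix (Fin m) (Fin 3) ℝ)
    (V : Matrix (Fin 3) (Fin m) ℝ) (c : ℝ) :
    (U * V + scalar (Fin m) c).charpoly
      = (X - C c) ^ (m - 3) * (V * U).charpoly.comp (X - C c) := by
  have h := charpoly_sub_scalar (U * V + scalar (Fin m) c) c
  rw [add_sub_cancel_right] at h
  have h' : (U * V).charpoly = X ^ (m - 3) * (V * U).charpoly := by
    simpa using charpoly_mul_comm_of_le U V (by simpa using hm)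
  have h2 := congrArg (fun p : ℝ[X] => p.comp (X - C c)) (h.symm.trans h')
  simpa [comp_assoc] using h2

theorem jacCplx_charpoly (n : ℕ) (hn : 2 ≤ n) (l0 l1 ε : ℝ) (x : Fin (2 * n) → ℝ) :
    (jacCplx n (one_le_two.trans hn) l0 l1 ε x).charpoly
      = X * (X - C ((x ⬝ᵥ x) * (l0 + 3 * l1))) * (X - C ((x ⬝ᵥ x) * l0)) ^ (2 * n - 2) := by
  set i0 : Fin (2 * n) := ⟨0, by omega⟩ with hi0
  set i1 : Fin (2 * n) := ⟨1, by omega⟩ with hi1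
  have h01 : i0 ≠ i1 := by simp [hi0, hi1]
  set u : Fin (2 * n) → ℝ := x i0 • Pi.single i0 1 + x i1 • Pi.single i1 1 with hu
  set φ : Fin (2 * n) → ℝ := x i0 • Pi.single i1 1 - x i1 • Pi.single i0 1 with hφ
  let U : Matrix (Fin (2 * n)) (Fin 3) ℝ := (of ![x, Jstd n x, u])ᵀ
  let V : Matrix (Fin 3) (Fin (2 * n)) ℝ := of ![-l0 • x, (3 * l1) • Jstd n x, ε • φ]
  have hJ0 : Jstd n x i0 = -x i1 := by
    change JstdFun n x i0 = _
    simp [JstdFun, hi0, hi1]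
  have hJ1 : Jstd n x i1 = x i0 := by
    change JstdFun n x i1 = _
    simp [JstdFun, hi0, hi1]
  have hmat : jacCplx n (one_le_two.trans hn) l0 l1 ε x
      = toLin' (U * V + scalar (Fin (2 * n)) ((x ⬝ᵥ x) * l0)) := by
    refine LinearMap.ext fun w => ?_
    have hV : V *ᵥ w = ![-l0 * (x ⬝ᵥ w), 3 * l1 * (Jstd n x ⬝ᵥ w),
        ε * (x i0 * w i1 - x i1 * w i0)] := by
      funext k
      change ![-l0 • x, (3 * l1) • Jstd n x, ε • φ] k ⬝ᵥ w = _
      fin_cases k <;> simp [hφ, sub_dotProduct]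
    have hU (a b c : ℝ) : U *ᵥ ![a, b, c] = a • x + b • Jstd n x + c • u := by
      funext k
      simp [U, mulVec, dotProduct, Fin.sum_univ_three, mul_comm]
    have hskew : x ⬝ᵥ Jstd n w = -(Jstd n x ⬝ᵥ w) := by rw [Jstd_dotProduct, neg_neg]
    have hxx : ∑ i, x i * x i = x ⬝ᵥ x := rfl
    have hJx : ∑ i, Jstd n x i * x i = 0 := Jstd_dotProduct_self n x
    rw [toLin'_apply, add_mulVec, ← mulVec_mulVec, hV, hU]
    funext k
    simp [jacCplx, dotL_apply_s12, hskew, hxx, hJx, ← hi0, ← hi1, hu]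
    ring
  have hVU : V * U = !![-l0 * (x ⬝ᵥ x), 0, -l0 * (x i0 ^ 2 + x i1 ^ 2);
      0, 3 * l1 * (x ⬝ᵥ x), 0; 0, ε * (x i0 ^ 2 + x i1 ^ 2), 0] := by
    have hent (a b : Fin 3) : (V * U) a b
        = ![-l0 • x, (3 * l1) • Jstd n x, ε • φ] a ⬝ᵥ ![x, Jstd n x, u] b := rfl
    ext a b
    rw [hent]
    fin_cases a <;> fin_cases b <;>
      simp [hu, hφ, sub_dotProduct, hJ0, hJ1, dotProduct_Jstd_self, Jstd_dotProduct_self,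
        Jstd_dotProduct_Jstd, h01, h01.symm] <;> ring_nf <;> simp
  have hcp : (V * U).charpoly
      = (X + C (l0 * (x ⬝ᵥ x))) * (X - C (3 * l1 * (x ⬝ᵥ x))) * X := by
    rw [hVU, charpoly, det_fin_three]
    simp
  rw [hmat, charpoly_toLin', charpoly_add_scalar_mul (by omega), hcp,
    show 2 * n - 2 = 2 * n - 3 + 1 by omega]
  simp only [mul_comp, add_comp, sub_comp, X_comp, C_comp, pow_succ, C_mul, C_add]
  ring

theorem spec_jacCplx (n : ℕ) (hn : 2 ≤ n) (l0 l1 ε : ℝ) (x : Fin (2 * n) → ℝ) :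
    spec (jacCplx n (one_le_two.trans hn) l0 l1 ε x)
      = (fun μ : ℂ => ((x ⬝ᵥ x : ℝ) : ℂ) * μ) '' {0, ((l0 + 3 * l1 : ℝ) : ℂ), (l0 : ℂ)} := by
  have hn' : 2 * n - 2 ≠ 0 := by omega
  ext z
  rw [spec, mem_rootSet_of_ne (LinearMap.charpoly_monic _).ne_zero, jacCplx_charpoly n hn]
  simp [hn', Set.image_insert_eq, sub_eq_zero, or_assoc]

/-- The Lemma of Section 7.1: for `A = λ₀A₀ + λ₁A_J + εℰ` on `ℝ^(2n)` and every
unit vector `x`, the characteristic polynomial of the Jacobi operator `J_A(x)` is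
`t·(t − (λ₀+3λ₁))·(t − λ₀)^(m−2)`; hence for `(λ₀,λ₁) ≠ (0,0)` the model
`(ℝ^(2n), A)` is an affine projective Osserman curvature model for every `ε`. -/
theorem stmt_12 (n : ℕ) (hn : 2 ≤ n) (l0 l1 ε : ℝ) :
    (∀ x w : Fin (2 * n) → ℝ,
      jacCplx n (by omega) l0 l1 ε x w
        = l0 • A0f (2 * n) w x x + l1 • AJf (2 * n) (Jstd n) w x x
          + ε • Ef (2 * n) (by omega) w x x) ∧
    (∀ x : Fin (2 * n) → ℝ, (∑ i, x i * x i) = 1 →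
      (jacCplx n (by omega) l0 l1 ε x).charpoly
        = X * (X - C (l0 + 3 * l1)) * (X - C l0) ^ (2 * n - 2)) ∧
    ((l0, l1) ≠ ((0 : ℝ), (0 : ℝ)) →
      ∀ v w : Fin (2 * n) → ℝ, v ≠ 0 → w ≠ 0 → ∃ s : ℝ, s ≠ 0 ∧
        spec (jacCplx n (by omega) l0 l1 ε v)
          = (fun μ : ℂ => (s : ℂ) * μ) '' spec (jacCplx n (by omega) l0 l1 ε w) ∧
        spec (jacCplx n (by omega) l0 l1 ε v) ≠ {0}) := by
  refine ⟨fun x w => ?_, fun x hx => ?_, fun hl v w hv hw => ?_⟩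
  · have h1 : ∑ i, w i * x i = x ⬝ᵥ w := dotProduct_comm w x
    have h2 : ∑ i, Jstd n w i * x i = x ⬝ᵥ Jstd n w := dotProduct_comm _ x
    funext k
    simp [jacCplx, A0f, AJf, Ef, dotL_apply_s12, h1, h2]
    ring
  · have hx' : x ⬝ᵥ x = 1 := hx
    simpa [hx'] using jacCplx_charpoly n hn l0 l1 ε x
  · have hv' : v ⬝ᵥ v ≠ 0 := dotProduct_self_eq_zero.not.mpr hv
    have hw' : w ⬝ᵥ w ≠ 0 := dotProduct_self_eq_zero.not.mpr hw
    refine ⟨(v ⬝ᵥ v) / (w ⬝ᵥ w), div_ne_zero hv' hw', ?_, fun h => hl ?_⟩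
    · rw [spec_jacCplx n hn, spec_jacCplx n hn, Set.image_image]
      refine congrArg (· '' _) (funext fun μ => ?_)
      have : ((w ⬝ᵥ w : ℝ) : ℂ) ≠ 0 := by exact_mod_cast hw'
      push_cast
      field_simp
    · rw [spec_jacCplx n hn] at h
      have hzero {c : ℝ} (hc : (c : ℂ) ∈ ({0, ((l0 + 3 * l1 : ℝ) : ℂ), (l0 : ℂ)} : Set ℂ)) :
          c = 0 := by
        have h' : ((v ⬝ᵥ v : ℝ) : ℂ) * (c : ℂ) = 0 := h.subset (Set.mem_image_of_mem _ hc)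
        exact (mul_eq_zero.mp (by exact_mod_cast h')).resolve_left hv'
      have h0 : l0 = 0 := hzero (by simp)
      have h1 : l0 + 3 * l1 = 0 := hzero (by simp)
      exact Prod.ext h0 (by simp; linarith)
end

section
/- Let Γ_{ij}{}^k : ℝ^m → ℝ (1 ≤ i,j,k ≤ m) be smooth functions with Γ_{ij}{}^k = Γ_{ji}{}^k, such that Γ_{ij}{}^k = 0 unless k > max(i,j), and such that Γ_{ij}{}^k(x) depends only on the coordinates (x₁,…,x_{k−1}) (i.e. Γ_{ij}{}^k(x) = Γ_{ij}{}^k(y) whenever x_l = y_l for all l < k). Define R_{ijk}{}^l := ∂_{x_i}Γ_{jk}{}^l − ∂_{x_j}Γ_{ik}{}^l + Σ_n (Γ_{in}{}^l Γ_{jk}{}^n − Γ_{jn}{}^l Γ_{ik}{}^n). Then for every point p ∈ ℝ^m and every vector x ∈ ℝ^m, the Jacobi operator J_p(x) : y ↦ Σ_{i,j,k,l} y^j x^i x^k R_{jik}{}^l(p)·e_l is nilpotent; equivalently its characteristic polynomial is t^m, i.e. Spec{J_p(x)} = {0}. -/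
open Polynomial

/-- The curvature tensor of the torsion-free connection with Christoffel symbols
`Γ`: `R_ijk^l = ∂_i Γ_jk^l − ∂_j Γ_ik^l + Σ_n (Γ_in^l Γ_jk^n − Γ_jn^l Γ_ik^n)`. -/
noncomputable def curvGen (m : ℕ) (Γ : Fin m → Fin m → Fin m → (Fin m → ℝ) → ℝ)
    (i j k l : Fin m) (x : Fin m → ℝ) : ℝ :=
  fderiv ℝ (Γ j k l) x (Pi.single i 1)
  - fderiv ℝ (Γ i k l) x (Pi.single j 1)
  + ∑ n, (Γ i n l x * Γ j k n x - Γ j n l x * Γ i k n x)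

/-- The Jacobi operator at the point `p` of the tangent vector `x`:
`J_p(x) : y ↦ Σ_{i,j,k,l} y^j x^i x^k R_{jik}^l(p) e_l`, as a linear map. -/
noncomputable def jacGen (m : ℕ) (Γ : Fin m → Fin m → Fin m → (Fin m → ℝ) → ℝ)
    (p x : Fin m → ℝ) : (Fin m → ℝ) →ₗ[ℝ] (Fin m → ℝ) :=
  ∑ i, ∑ j, ∑ k, (x i * x k) •
    ((LinearMap.proj j : (Fin m → ℝ) →ₗ[ℝ] ℝ).smulRight
      (fun l => curvGen m Γ j i k l p))

theorem fderiv_single_eq_zero_of_depends {m : ℕ} {f : (Fin m → ℝ) → ℝ} {k j : Fin m}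
    (hf : Differentiable ℝ f) (hdep : ∀ x y : Fin m → ℝ, (∀ l < k, x l = y l) → f x = f y)
    (hkj : k ≤ j) (p : Fin m → ℝ) : fderiv ℝ f p (Pi.single j 1) = 0 := by
  have hline (t : ℝ) : f (p + t • Pi.single j 1) = f p :=
    hdep _ _ fun l hl => by simp [(hl.trans_le hkj).ne]
  rw [← (hf p).lineDeriv_eq_fderiv, lineDeriv]
  simp [hline]

/-- `R_jik^l` vanishes unless `j < l`. -/
theorem curvGen_eq_zero {m : ℕ} {Γ : Fin m → Fin m → Fin m → (Fin m → ℝ) → ℝ}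
    (hdiff : ∀ i j k, Differentiable ℝ (Γ i j k))
    (hupper : ∀ i j k, ¬ (i < k ∧ j < k) → ∀ x, Γ i j k x = 0)
    (hdep : ∀ i j k (x y : Fin m → ℝ), (∀ l < k, x l = y l) → Γ i j k x = Γ i j k y)
    {j l : Fin m} (hlj : l ≤ j) (i k : Fin m) (p : Fin m → ℝ) : curvGen m Γ j i k l p = 0 := by
  have hzero (n : Fin m) : Γ j n l = 0 :=
    funext fun x => hupper j n l (fun h => h.1.not_ge hlj) x
  have hprod (n : Fin m) : Γ i n l p * Γ j k n p = 0 := by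
    by_cases hn : n < l
    · rw [hupper j k n (fun h => (h.1.trans hn).not_ge hlj), mul_zero]
    · rw [hupper i n l (fun h => hn h.2), zero_mul]
  simp [curvGen, hzero, hprod,
    fderiv_single_eq_zero_of_depends (hdiff i k l) (hdep i k l) hlj]

theorem LinearMap.charpoly_eq_X_pow_of_strictly_lower {m : ℕ} {R : Type*} [CommRing R]
    (f : (Fin m → R) →ₗ[R] (Fin m → R)) (hf : ∀ l j, l ≤ j → f (Pi.single j 1) l = 0) :
    f.charpoly = X ^ m := by
  have hentry (l j : Fin m) (h : l ≤ j) : LinearMap.toMatrix' f l j = 0 := by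
    rw [LinearMap.toMatrix'_apply]
    exact hf l j h
  rw [← f.charpoly_toMatrix (Pi.basisFun R (Fin m)), LinearMap.toMatrix_eq_toMatrix',
    ← Matrix.charpoly_transpose, Matrix.charpoly_of_isUpperTriangular]
  · simp [hentry]
  · exact fun i j h => hentry j i h.le

/-- Theorem 1.1 (García-Río et al.): if the smooth symmetric Christoffel symbols
`Γ_ij^k` vanish unless `k > max(i,j)` and `Γ_ij^k` depends only on the first
`k-1` coordinates (0-based: on the coordinates `x_l` with `l < k`), then the
associated torsion-free connection on `ℝ^m` is affine Osserman: every Jacobi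
operator is nilpotent, i.e. has characteristic polynomial `t^m` and
`Spec J_p(x) = {0}`. -/
theorem stmt_15 (m : ℕ) (hm : 1 ≤ m)
    (Γ : Fin m → Fin m → Fin m → (Fin m → ℝ) → ℝ)
    (hsmooth : ∀ i j k : Fin m, ContDiff ℝ (⊤ : ℕ∞) (Γ i j k))
    (hsym : ∀ (i j k : Fin m) (x : Fin m → ℝ), Γ i j k x = Γ j i k x)
    (hupper : ∀ i j k : Fin m, ¬ (max (i : ℕ) (j : ℕ) < (k : ℕ)) →
      ∀ x : Fin m → ℝ, Γ i j k x = 0)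
    (hdep : ∀ (i j k : Fin m) (x y : Fin m → ℝ),
      (∀ l : Fin m, (l : ℕ) < (k : ℕ) → x l = y l) → Γ i j k x = Γ i j k y) :
    ∀ p x : Fin m → ℝ,
      (jacGen m Γ p x).charpoly = X ^ m ∧ spec (jacGen m Γ p x) = {0} := by
  intro p x
  have hcharpoly : (jacGen m Γ p x).charpoly = X ^ m := by
    refine LinearMap.charpoly_eq_X_pow_of_strictly_lower _ fun l j hlj => ?_
    have hcurv (i k : Fin m) : curvGen m Γ j i k l p = 0 :=
      curvGen_eq_zero (fun i j k => (hsmooth i j k).differentiable (by simp))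
        (fun i j k h => hupper i j k (by rwa [max_lt_iff])) hdep hlj i k p
    simp [jacGen, LinearMap.sum_apply, Finset.sum_apply, Pi.single_apply, hcurv]
  refine ⟨hcharpoly, ?_⟩
  rw [spec, hcharpoly, rootSet_X_pow (by omega)]
end
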